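/- arXiv:2405.14041 — 3 statements merged into one kernel-verified Lean document; each statement's English description precedes it below -/
import Mathlib

section
/- The pattern sets {123, 213} and {231, 312} are shape-Wilf-equivalent. -/
/-- A pattern is a permutation of `Fin k` for some `k : ℕ` (a permutation of length `k`,
written 0-indexed). -/
def Pattern : Type := Σ k : ℕ, Equiv.Perm (Fin k)

/-- Build a pattern from an explicit vector of values (0-indexed one-line notation). -/
noncomputable def mkPattern {k : ℕ} (v : Fin k → Fin k) (h : Function.Bijective v := by decide) : Pattern :=
  ⟨k, Equiv.ofBijective v h⟩

/-- The permutation `π` of length `n` contains an occurrence of the pattern `p`: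
there are indices `i₁ < ⋯ < i_k` (given by a strictly monotone `f`) such that
`π (f a) < π (f b) ↔ p a < p b` for all `a b`. -/
def PermContains {n : ℕ} (π : Equiv.Perm (Fin n)) (p : Pattern) : Prop :=
  ∃ f : Fin p.1 → Fin n, StrictMono f ∧
    ∀ a b : Fin p.1, π (f a) < π (f b) ↔ p.2 a < p.2 b

/-- `π` avoids every pattern in the set `S`. -/
def AvoidsSet {n : ℕ} (π : Equiv.Perm (Fin n)) (S : Set Pattern) : Prop :=
  ∀ p ∈ S, ¬ PermContains π p

/-- Two sets of patterns are Wilf-equivalent: for every `n ≥ 1`, the number of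
permutations of length `n` avoiding every pattern of `S1` equals the number of
permutations of length `n` avoiding every pattern of `S2`. -/
def WilfEquiv (S1 S2 : Set Pattern) : Prop :=
  ∀ n : ℕ, 1 ≤ n →
    Nat.card {π : Equiv.Perm (Fin n) // AvoidsSet π S1} =
    Nat.card {π : Equiv.Perm (Fin n) // AvoidsSet π S2}

/-- A Ferrers board on `[n] × [n]`: a downward-closed set of cells `(column, row)`
(0-indexed). -/
structure FerrersBoard (n : ℕ) where
  cells : Set (Fin n × Fin n)
  downward_closed : ∀ ⦃i j i' j' : Fin n⦄, (i, j) ∈ cells → i' ≤ i → j' ≤ j → (i', j') ∈ cells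

/-- `σ` is a filling of the Ferrers board `F`: each rook `(i, σ i)` lies on the board. -/
def IsFilling {n : ℕ} (F : FerrersBoard n) (σ : Equiv.Perm (Fin n)) : Prop :=
  ∀ i : Fin n, (i, σ i) ∈ F.cells

/-- The filling `σ` of `F` contains an occurrence of the pattern `p`: there are
columns `f 0 < f 1 < ⋯` whose rooks are order-isomorphic to `p`, and the whole
rectangle spanned by the occurrence lies in `F` (equivalently, by downward closure,
the top-right corner cell lies in `F`). -/
def FillingContains {n : ℕ} (F : FerrersBoard n) (σ : Equiv.Perm (Fin n)) (p : Pattern) : Prop :=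
  ∃ f : Fin p.1 → Fin n, StrictMono f ∧
    (∀ a b : Fin p.1, σ (f a) < σ (f b) ↔ p.2 a < p.2 b) ∧
    (∀ a b : Fin p.1, (f a, σ (f b)) ∈ F.cells)

/-- The filling `σ` of `F` avoids every pattern in the set `S`. -/
def FillingAvoidsSet {n : ℕ} (F : FerrersBoard n) (σ : Equiv.Perm (Fin n)) (S : Set Pattern) : Prop :=
  ∀ p ∈ S, ¬ FillingContains F σ p

/-- Two sets of patterns are shape-Wilf-equivalent: for every `n ≥ 1` and every
Ferrers board `F` on `[n] × [n]`, the number of fillings of `F` avoiding every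
pattern of `S1` equals the number of fillings of `F` avoiding every pattern of `S2`. -/
def ShapeWilfEquiv (S1 S2 : Set Pattern) : Prop :=
  ∀ n : ℕ, 1 ≤ n → ∀ F : FerrersBoard n,
    Nat.card {σ : Equiv.Perm (Fin n) // IsFilling F σ ∧ FillingAvoidsSet F σ S1} =
    Nat.card {σ : Equiv.Perm (Fin n) // IsFilling F σ ∧ FillingAvoidsSet F σ S2}

/-- A filling of `F` in which no rook has two rooks to its left and below it. -/
def AvoidsTopRight {n : ℕ} (F : FerrersBoard n) (σ : Equiv.Perm (Fin n)) : Prop :=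
  IsFilling F σ ∧ ∀ i j k : Fin n, i < j → j < k → ¬(σ i < σ k ∧ σ j < σ k)

/-- A filling of `F` avoiding `231` and `312`, written out on triples of columns. -/
def AvoidsCyclic {n : ℕ} (F : FerrersBoard n) (σ : Equiv.Perm (Fin n)) : Prop :=
  IsFilling F σ ∧ ∀ i j k : Fin n, i < j → j < k →
    ¬(σ k < σ i ∧ σ i < σ j ∧ (k, σ j) ∈ F.cells) ∧
    ¬(σ j < σ k ∧ σ k < σ i ∧ (k, σ i) ∈ F.cells)

lemma fillingContains_three {n : ℕ} (F : FerrersBoard n) (σ : Equiv.Perm (Fin n))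
    (v : Fin 3 → Fin 3) (hv : Function.Bijective v) :
    FillingContains F σ (mkPattern v hv) ↔ ∃ i j k : Fin n, i < j ∧ j < k ∧
      (∀ a b : Fin 3, σ (![i, j, k] a) < σ (![i, j, k] b) ↔ v a < v b) ∧
      ∀ a b : Fin 3, (![i, j, k] a, σ (![i, j, k] b)) ∈ F.cells := by
  constructor
  · rintro ⟨f, hf, h1, h2⟩
    change Fin 3 → Fin n at f
    have hfe : ![f 0, f 1, f 2] = f := by
      funext a; fin_cases a <;> rfl
    refine ⟨f 0, f 1, f 2, hf (show (0 : Fin 3) < 1 by decide),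
      hf (show (1 : Fin 3) < 2 by decide), ?_, ?_⟩
    · rw [hfe]; exact h1
    · rw [hfe]; exact h2
  · rintro ⟨i, j, k, hij, hjk, h1, h2⟩
    refine ⟨![i, j, k], ?_, h1, h2⟩
    change StrictMono (![i, j, k] : Fin 3 → Fin n)
    intro a b hab
    have := hij.trans hjk
    fin_cases a <;> fin_cases b <;> simp_all

lemma fillingContains_of_triple {n : ℕ} {F : FerrersBoard n} {σ : Equiv.Perm (Fin n)}
    {v : Fin 3 → Fin 3} {hv : Function.Bijective v} {i j k : Fin n} (hij : i < j) (hjk : j < k)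
    (hv' : ∀ a b : Fin 3, σ (![i, j, k] a) < σ (![i, j, k] b) ↔ v a < v b)
    (hF : ∀ a : Fin 3, (k, σ (![i, j, k] a)) ∈ F.cells) :
    FillingContains F σ (mkPattern v hv) := by
  refine (fillingContains_three F σ v hv).2 ⟨i, j, k, hij, hjk, hv', fun a b => ?_⟩
  refine F.downward_closed (hF b) ?_ le_rfl
  fin_cases a
  · exact (hij.trans hjk).le
  · exact hjk.le
  · exact le_rfl

lemma avoidsTopRight_iff {n : ℕ} (F : FerrersBoard n) (σ : Equiv.Perm (Fin n)) :
    IsFilling F σ ∧ FillingAvoidsSet F σ {mkPattern ![0,1,2], mkPattern ![1,0,2]} ↔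
      AvoidsTopRight F σ := by
  refine and_congr_right fun hfill => ?_
  simp only [FillingAvoidsSet, Set.mem_insert_iff, Set.mem_singleton_iff, forall_eq_or_imp,
    forall_eq]
  constructor
  · rintro ⟨h1, h2⟩ i j k hij hjk ⟨hik', hjk'⟩
    have hF : ∀ a : Fin 3, (k, σ (![i, j, k] a)) ∈ F.cells := fun a =>
      F.downward_closed (hfill k) le_rfl (by fin_cases a <;> simp [hik'.le, hjk'.le])
    rcases lt_trichotomy (σ i) (σ j) with h | h | h
    · refine h1 (fillingContains_of_triple hij hjk (fun a b => ?_) hF)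
      fin_cases a <;> fin_cases b <;> simp [h, h.le, hik', hik'.le, hjk', hjk'.le]
    · exact hij.ne (σ.injective h)
    · refine h2 (fillingContains_of_triple hij hjk (fun a b => ?_) hF)
      fin_cases a <;> fin_cases b <;> simp [h, h.le, hik', hik'.le, hjk', hjk'.le]
  · intro h
    constructor <;>
    · rw [fillingContains_three]
      rintro ⟨i, j, k, hij, hjk, hv, -⟩
      exact h i j k hij hjk ⟨(hv 0 2).2 (by decide), (hv 1 2).2 (by decide)⟩

lemma avoidsCyclic_iff {n : ℕ} (F : FerrersBoard n) (σ : Equiv.Perm (Fin n)) :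
    IsFilling F σ ∧ FillingAvoidsSet F σ {mkPattern ![1,2,0], mkPattern ![2,0,1]} ↔
      AvoidsCyclic F σ := by
  refine and_congr_right fun hfill => ?_
  simp only [FillingAvoidsSet, Set.mem_insert_iff, Set.mem_singleton_iff, forall_eq_or_imp,
    forall_eq]
  constructor
  · rintro ⟨h1, h2⟩ i j k hij hjk
    constructor
    · rintro ⟨hki, hij', hF⟩
      have hkj := hki.trans hij'
      refine h1 (fillingContains_of_triple hij hjk (fun a b => ?_)
        fun a => F.downward_closed hF le_rfl ?_)
      · fin_cases a <;> fin_cases b <;> simp [hki, hki.le, hij', hij'.le, hkj, hkj.le]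
      · fin_cases a <;> simp [hij'.le, hkj.le]
    · rintro ⟨hjk', hki, hF⟩
      have hji := hjk'.trans hki
      refine h2 (fillingContains_of_triple hij hjk (fun a b => ?_)
        fun a => F.downward_closed hF le_rfl ?_)
      · fin_cases a <;> fin_cases b <;> simp [hki, hki.le, hjk', hjk'.le, hji, hji.le]
      · fin_cases a <;> simp [hki.le, hji.le]
  · intro h
    constructor
    · rw [fillingContains_three]
      rintro ⟨i, j, k, hij, hjk, hv, hF⟩
      exact (h i j k hij hjk).1
        ⟨(hv 2 0).2 (by decide), (hv 0 1).2 (by decide), hF 2 1⟩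
    · rw [fillingContains_three]
      rintro ⟨i, j, k, hij, hjk, hv, hF⟩
      exact (h i j k hij hjk).2
        ⟨(hv 1 2).2 (by decide), (hv 2 0).2 (by decide), hF 2 0⟩

/-- Append a last column with a rook in row `r`, shifting the rows from `r` on up by one. -/
def insertLast {n : ℕ} (r : Fin (n + 1)) (τ : Equiv.Perm (Fin n)) : Equiv.Perm (Fin (n + 1)) :=
  ((finSuccEquiv' (Fin.last n)).trans (Equiv.optionCongr τ)).trans (finSuccEquiv' r).symm

@[simp] lemma insertLast_last {n : ℕ} (r : Fin (n + 1)) (τ : Equiv.Perm (Fin n)) :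
    insertLast r τ (Fin.last n) = r := by
  simp [insertLast]

@[simp] lemma insertLast_castSucc {n : ℕ} (r : Fin (n + 1)) (τ : Equiv.Perm (Fin n)) (i : Fin n) :
    insertLast r τ i.castSucc = r.succAbove (τ i) := by
  rw [← Fin.succAbove_last]
  simp [insertLast, -Fin.succAbove_last]

lemma insertLast_bijective (n : ℕ) :
    Function.Bijective fun x : Fin (n + 1) × Equiv.Perm (Fin n) => insertLast x.1 x.2 := by
  rw [Fintype.bijective_iff_injective_and_card]
  constructor
  · rintro ⟨r, τ⟩ ⟨s, ρ⟩ h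
    have h : insertLast r τ = insertLast s ρ := h
    obtain rfl : r = s := by simpa using congrArg (· (Fin.last n)) h
    have : τ = ρ := by
      ext i : 1
      have := congrArg (· i.castSucc) h
      simpa using this
    rw [this]
  · simp [Fintype.card_perm, Nat.factorial_succ]

lemma card_insertLast {n : ℕ} (P : Equiv.Perm (Fin (n + 1)) → Prop) (Q : Equiv.Perm (Fin n) → Prop)
    (m : ℕ) (hPQ : ∀ r τ, P (insertLast r τ) → Q τ)
    (hm : ∀ τ, Q τ → Nat.card {r // P (insertLast r τ)} = m) :
    Nat.card {σ // P σ} = Nat.card {τ // Q τ} * m := by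
  let e : (Σ τ : {τ // Q τ}, {r // P (insertLast r τ.1)}) → {σ // P σ} :=
    fun x => ⟨insertLast x.2.1 x.1.1, x.2.2⟩
  have he : Function.Bijective e := by
    constructor
    · rintro ⟨⟨τ, hτ⟩, ⟨r, hr⟩⟩ ⟨⟨ρ, hρ⟩, ⟨s, hs⟩⟩ h
      have := @(insertLast_bijective n).1 (r, τ) (s, ρ) (congrArg Subtype.val h)
      obtain ⟨rfl, rfl⟩ := Prod.mk.inj this
      rfl
    · rintro ⟨σ, hσ⟩
      obtain ⟨⟨r, τ⟩, rfl⟩ := (insertLast_bijective n).2 σ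
      exact ⟨⟨⟨τ, hPQ r τ hσ⟩, ⟨r, hσ⟩⟩, rfl⟩
  classical
  rw [← Nat.card_eq_of_bijective e he, Nat.card_sigma, Finset.sum_congr rfl fun τ _ => hm τ.1 τ.2]
  simp

namespace FerrersBoard

/-- The board left after deleting the last column together with a row meeting it. -/
def eraseLast {n : ℕ} (F : FerrersBoard (n + 1)) : FerrersBoard n where
  cells := {c | (c.1.castSucc, c.2.succ) ∈ F.cells}
  downward_closed := fun _ _ _ _ h hi hj =>
    F.downward_closed h (Fin.castSucc_le_castSucc_iff.2 hi) (Fin.succ_le_succ_iff.2 hj)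

lemma mem_eraseLast {n : ℕ} (F : FerrersBoard (n + 1)) (i j : Fin n) :
    (i, j) ∈ F.eraseLast.cells ↔ (i.castSucc, j.succ) ∈ F.cells := Iff.rfl

lemma mem_succAbove_iff {n : ℕ} (F : FerrersBoard (n + 1)) {c r : Fin (n + 1)}
    (hr : (c, r) ∈ F.cells) (j : Fin n) :
    (c, r.succAbove j) ∈ F.cells ↔ (c, j.succ) ∈ F.cells := by
  by_cases h : j.castSucc < r
  · rw [Fin.succAbove_of_castSucc_lt _ _ h]
    exact ⟨fun _ => F.downward_closed hr le_rfl (Fin.castSucc_lt_iff_succ_le.1 h),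
      fun _ => F.downward_closed hr le_rfl h.le⟩
  · rw [Fin.succAbove_of_le_castSucc _ _ (not_lt.1 h)]

lemma exists_height {n : ℕ} (F : FerrersBoard (n + 1)) :
    ∃ k ≤ n + 1, ∀ r : Fin (n + 1), (Fin.last n, r) ∈ F.cells ↔ r.val < k := by
  classical
  by_cases h : ∃ k : ℕ, ∃ hk : k < n + 1, (Fin.last n, (⟨k, hk⟩ : Fin (n + 1))) ∉ F.cells
  · obtain ⟨hk, hk'⟩ := Nat.find_spec h
    refine ⟨Nat.find h, hk.le, fun r => ⟨fun hr => ?_, fun hr => ?_⟩⟩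
    · by_contra hlt
      exact hk' (F.downward_closed hr le_rfl (not_lt.1 hlt))
    · have := Nat.find_min h hr
      push Not at this
      exact this r.2
  · push Not at h
    exact ⟨n + 1, le_rfl, fun r => ⟨fun _ => r.2, fun _ => h r.1 r.2⟩⟩

end FerrersBoard

lemma isFilling_insertLast {n : ℕ} (F : FerrersBoard (n + 1)) (r : Fin (n + 1))
    (τ : Equiv.Perm (Fin n)) :
    IsFilling F (insertLast r τ) ↔ (Fin.last n, r) ∈ F.cells ∧ IsFilling F.eraseLast τ := by
  simp only [IsFilling, Fin.forall_fin_succ', insertLast_castSucc, insertLast_last]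
  rw [and_comm]
  refine and_congr_right fun hr => forall_congr' fun i => ?_
  exact F.mem_succAbove_iff (F.downward_closed hr (Fin.le_last _) le_rfl) _

lemma forall_triple_succ {n : ℕ} (P : Fin (n + 1) → Fin (n + 1) → Fin (n + 1) → Prop) :
    (∀ i j k, i < j → j < k → P i j k) ↔
      (∀ i j k : Fin n, i < j → j < k → P i.castSucc j.castSucc k.castSucc) ∧
      ∀ i j : Fin n, i < j → P i.castSucc j.castSucc (Fin.last n) := by
  constructor
  · intro h
    exact ⟨fun i j k hij hjk => h _ _ _ (Fin.castSucc_lt_castSucc_iff.2 hij)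
      (Fin.castSucc_lt_castSucc_iff.2 hjk),
      fun i j hij => h _ _ _ (Fin.castSucc_lt_castSucc_iff.2 hij) (Fin.castSucc_lt_last j)⟩
  · rintro ⟨h1, h2⟩ i j k hij hjk
    obtain ⟨j, rfl⟩ := Fin.exists_castSucc_eq.2 (hjk.trans_le (Fin.le_last k)).ne
    obtain ⟨i, rfl⟩ := Fin.exists_castSucc_eq.2 (hij.trans (Fin.castSucc_lt_last j)).ne
    rw [Fin.castSucc_lt_castSucc_iff] at hij
    induction k using Fin.lastCases with
    | last => exact h2 i j hij
    | cast k => exact h1 i j k hij (Fin.castSucc_lt_castSucc_iff.1 hjk)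

lemma avoidsTopRight_insertLast {n : ℕ} (F : FerrersBoard (n + 1)) (r : Fin (n + 1))
    (τ : Equiv.Perm (Fin n)) :
    AvoidsTopRight F (insertLast r τ) ↔
      (AvoidsTopRight F.eraseLast τ ∧ (Fin.last n, r) ∈ F.cells) ∧
        ∀ i j : Fin n, i < j → ¬((τ i).castSucc < r ∧ (τ j).castSucc < r) := by
  rw [AvoidsTopRight, AvoidsTopRight, isFilling_insertLast, forall_triple_succ]
  simp only [insertLast_castSucc, insertLast_last, Fin.succAbove_lt_succAbove_iff,
    Fin.succAbove_lt_iff_castSucc_lt]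
  tauto

lemma avoidsCyclic_insertLast {n : ℕ} (F : FerrersBoard (n + 1)) (r : Fin (n + 1))
    (τ : Equiv.Perm (Fin n)) :
    AvoidsCyclic F (insertLast r τ) ↔
      (AvoidsCyclic F.eraseLast τ ∧ (Fin.last n, r) ∈ F.cells) ∧
        ∀ i j : Fin n, i < j →
          ¬(r ≤ (τ i).castSucc ∧ τ i < τ j ∧ (Fin.last n, (τ j).succ) ∈ F.cells) ∧
          ¬((τ j).castSucc < r ∧ r ≤ (τ i).castSucc ∧ (Fin.last n, (τ i).succ) ∈ F.cells) := by
  rw [AvoidsCyclic, AvoidsCyclic, isFilling_insertLast, forall_triple_succ]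
  by_cases hr : (Fin.last n, r) ∈ F.cells
  · have hr' : ∀ c : Fin n, (c.castSucc, r) ∈ F.cells :=
      fun c => F.downward_closed hr (Fin.le_last _) le_rfl
    simp only [insertLast_castSucc, insertLast_last, Fin.succAbove_lt_succAbove_iff,
      Fin.succAbove_lt_iff_castSucc_lt, Fin.lt_succAbove_iff_le_castSucc,
      F.mem_succAbove_iff hr, F.mem_succAbove_iff (hr' _), F.mem_eraseLast]
    tauto
  · tauto

lemma card_subtype_eq_two {α : Type*} {P : α → Prop} {a b : α} (hab : a ≠ b)
    (h : ∀ x, P x ↔ x = a ∨ x = b) : Nat.card {x // P x} = 2 := by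
  have : {x | P x} = {a, b} := Set.ext h
  exact (congrArg Set.ncard this).trans (Set.ncard_pair hab)

lemma card_avoidsTopRight_extensions {n k : ℕ} (F : FerrersBoard (n + 1)) (hk : k ≤ n + 1)
    (hF : ∀ r : Fin (n + 1), (Fin.last n, r) ∈ F.cells ↔ r.val < k)
    (τ : Equiv.Perm (Fin n)) (hτ : AvoidsTopRight F.eraseLast τ) :
    Nat.card {r // AvoidsTopRight F (insertLast r τ)} = min 2 k := by
  have key : ∀ r, AvoidsTopRight F (insertLast r τ) ↔ r.val < min 2 k := by
    intro r
    rw [avoidsTopRight_insertLast, hF]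
    simp only [hτ, true_and]
    rw [lt_min_iff, and_comm]
    refine and_congr_left fun hrk => ⟨fun h => ?_, fun hr i j hij ⟨hi, hj⟩ => ?_⟩
    · by_contra hlt
      have h0 : 0 < n := by omega
      have h1 : 1 < n := by omega
      have hne : τ.symm ⟨0, h0⟩ ≠ τ.symm ⟨1, h1⟩ := by simp
      rcases lt_or_gt_of_ne hne with hl | hl
      · refine h _ _ hl ⟨?_, ?_⟩ <;>
          simp only [Fin.lt_def, Fin.val_castSucc, Equiv.apply_symm_apply] <;> omega
      · refine h _ _ hl ⟨?_, ?_⟩ <;>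
          simp only [Fin.lt_def, Fin.val_castSucc, Equiv.apply_symm_apply] <;> omega
    · have : τ i ≠ τ j := τ.injective.ne hij.ne
      simp only [Fin.lt_def, Fin.val_castSucc] at hi hj
      omega
  simp only [key]
  have hle : min 2 k ≤ n + 1 := (min_le_right _ _).trans hk
  refine (Nat.card_congr ?_).trans (Nat.card_fin (min 2 k))
  exact
    ⟨fun r => ⟨r.1, r.2⟩, fun r => ⟨⟨r, r.2.trans_le hle⟩, r.2⟩, fun _ => rfl, fun _ => rfl⟩

lemma card_avoidsCyclic_extensions {n k : ℕ} (F : FerrersBoard (n + 1)) (hk : k ≤ n + 1)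
    (hF : ∀ r : Fin (n + 1), (Fin.last n, r) ∈ F.cells ↔ r.val < k)
    (τ : Equiv.Perm (Fin n)) (hτ : AvoidsCyclic F.eraseLast τ) :
    Nat.card {r // AvoidsCyclic F (insertLast r τ)} = min 2 k := by
  simp only [avoidsCyclic_insertLast, hF, hτ, true_and]
  simp only [Fin.lt_def, Fin.le_def, Fin.val_castSucc, Fin.val_succ]
  rcases k with _ | _ | k
  · simp
  · rw [min_eq_right (by omega), Nat.card_eq_one_iff_unique]
    refine ⟨⟨fun a b => Subtype.ext (Fin.ext ?_)⟩, ⟨⟨0, ?_⟩⟩⟩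
    · have := a.2.1
      have := b.2.1
      omega
    · refine ⟨by simp, fun i j _ => ⟨?_, ?_⟩⟩ <;> omega
  · rw [min_eq_left (by omega)]
    have hn : k < n := by omega
    obtain ⟨c, hc, hmax⟩ := (Finset.univ.filter fun i => (τ i).val ≤ k).exists_max_image id
      ⟨τ.symm ⟨k, hn⟩, by simp⟩
    simp only [Finset.mem_filter, Finset.mem_univ, true_and, id] at hc hmax
    have hmax' : ∀ i, (τ i).val ≤ k → i ≠ c → i.val < c.val :=
      fun i hi hne => lt_of_le_of_ne (hmax i hi) (Fin.val_injective.ne hne)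
    have hcell : ∀ j : Fin n, j.val ≤ k → (c, j) ∈ F.eraseLast.cells := fun j hj =>
      F.downward_closed ((hF _).2 (by simpa using hj)) (Fin.le_last _) le_rfl
    refine card_subtype_eq_two (a := ⟨k + 1, by omega⟩) (b := (τ c).castSucc) ?_ fun r => ?_
    · simp only [ne_eq, Fin.ext_iff, Fin.val_castSucc]
      omega
    constructor
    · rintro ⟨hr, h⟩
      by_contra! hne
      obtain ⟨hne1, hne2⟩ := hne
      simp only [ne_eq, Fin.ext_iff, Fin.val_castSucc] at hne1 hne2
      obtain ⟨d, hd⟩ : ∃ d, (τ d).val = r.val :=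
        ⟨τ.symm ⟨r.val, by omega⟩, by simp⟩
      have hdc : d.val < c.val := hmax' d (by omega) (by rintro rfl; exact hne2 hd.symm)
      have := h d c hdc
      omega
    · rintro (rfl | rfl)
      · refine ⟨by simp, fun i j _ => ⟨?_, ?_⟩⟩ <;> dsimp only <;> omega
      · simp only [Fin.val_castSucc]
        refine ⟨by omega, fun i j hij => ⟨?_, ?_⟩⟩
        · rintro ⟨h1, h2, h3⟩
          have hj : j.val < c.val := hmax' j (by omega) (by rintro rfl; omega)
          have hi : τ i ≠ τ c := τ.injective.ne (by rintro rfl; omega)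
          refine (hτ.2 i j c hij hj).1 ⟨?_, h2, hcell _ (by omega)⟩
          exact lt_of_le_of_ne h1 hi.symm
        · rintro ⟨h1, h2, h3⟩
          have hj : j.val < c.val := hmax' j (by omega) (by rintro rfl; omega)
          have hi : τ i ≠ τ c := τ.injective.ne (by rintro rfl; omega)
          refine (hτ.2 i j c hij hj).2 ⟨h1, ?_, hcell _ (by omega)⟩
          exact lt_of_le_of_ne h2 hi.symm

lemma card_avoidsTopRight_eq_card_avoidsCyclic (n : ℕ) (F : FerrersBoard n) :
    Nat.card {σ // AvoidsTopRight F σ} = Nat.card {σ // AvoidsCyclic F σ} := by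
  induction n with
  | zero =>
    exact Nat.card_congr (Equiv.subtypeEquivRight fun σ =>
      ⟨fun _ => ⟨fun i => i.elim0, fun i => i.elim0⟩, fun _ => ⟨fun i => i.elim0, fun i => i.elim0⟩⟩)
  | succ n ih =>
    obtain ⟨k, hk, hF⟩ := F.exists_height
    rw [card_insertLast _ (AvoidsTopRight F.eraseLast) (min 2 k)
        (fun r τ h => ((avoidsTopRight_insertLast F r τ).1 h).1.1)
        (card_avoidsTopRight_extensions F hk hF),
      card_insertLast _ (AvoidsCyclic F.eraseLast) (min 2 k)
        (fun r τ h => ((avoidsCyclic_insertLast F r τ).1 h).1.1)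
        (card_avoidsCyclic_extensions F hk hF), ih]

/-- The pattern sets {123, 213} and {231, 312} are shape-Wilf-equivalent. -/
theorem stmt8 : ShapeWilfEquiv {mkPattern ![0,1,2], mkPattern ![1,0,2]} {mkPattern ![1,2,0], mkPattern ![2,0,1]} := by
  intro n _ F
  simp only [avoidsTopRight_iff, avoidsCyclic_iff]
  exact card_avoidsTopRight_eq_card_avoidsCyclic n F
end

section
/- The pattern sets {312,321}, {132,231}, {123,213}, {231,321}, and {213,312} are pairwise shape-Wilf-equivalent. -/
/-- The filling `σ` of `F` contains an occurrence, inside a rectangle of `F`, of three rooks in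
increasing column order whose rows are related by `R`. -/
def HasTriple (R : ℕ → ℕ → ℕ → Prop) {n : ℕ} (F : FerrersBoard n) (σ : Equiv.Perm (Fin n)) :
    Prop :=
  ∃ i j k : Fin n, i < j ∧ j < k ∧ R (σ i) (σ j) (σ k) ∧
    (k, σ i) ∈ F.cells ∧ (k, σ j) ∈ F.cells ∧ (k, σ k) ∈ F.cells

/-- The fillings of `F` without a triple of rooks related by `R`. -/
abbrev TripleAvoiders (R : ℕ → ℕ → ℕ → Prop) {n : ℕ} (F : FerrersBoard n) : Type :=
  {σ : Equiv.Perm (Fin n) // IsFilling F σ ∧ ¬ HasTriple R F σ}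

/-- The maximum comes first (312 or 321). -/
def MaxFirst (a b c : ℕ) : Prop := b < a ∧ c < a

/-- The maximum comes second (132 or 231). -/
def MaxMid (a b c : ℕ) : Prop := a < b ∧ c < b

/-- The maximum comes last (123 or 213). -/
def MaxLast (a b c : ℕ) : Prop := a < c ∧ b < c

/-- The minimum comes last (231 or 321). -/
def MinLast (a b c : ℕ) : Prop := c < a ∧ c < b

/-- The minimum comes second (213 or 312). -/
def MinMid (a b c : ℕ) : Prop := b < a ∧ b < c

/-- The board obtained by deleting the first column and the top row. -/
def FerrersBoard.shrink {n : ℕ} (F : FerrersBoard (n + 1)) : FerrersBoard n where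
  cells := {x | (x.1.succ, x.2.castSucc) ∈ F.cells}
  downward_closed := fun _ _ _ _ h hi hj =>
    F.downward_closed h (Fin.succ_le_succ_iff.2 hi) (Fin.castSucc_le_castSucc_iff.2 hj)

/-- The board reflected in the main diagonal. -/
def FerrersBoard.transpose {n : ℕ} (F : FerrersBoard n) : FerrersBoard n where
  cells := {x | (x.2, x.1) ∈ F.cells}
  downward_closed := fun _ _ _ _ h hi hj => F.downward_closed h hj hi

/-- Insert a rook in a new column at position `c` and a new top row. -/
def insertTop {n : ℕ} (c : Fin (n + 1)) (τ : Equiv.Perm (Fin n)) : Equiv.Perm (Fin (n + 1)) :=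
  (finSuccEquiv' c).trans (τ.optionCongr.trans (finSuccEquiv' (Fin.last n)).symm)

@[simp]
theorem insertTop_self {n : ℕ} (c : Fin (n + 1)) (τ : Equiv.Perm (Fin n)) :
    insertTop c τ c = Fin.last n := by
  simp [insertTop]

@[simp]
theorem insertTop_succAbove {n : ℕ} (c : Fin (n + 1)) (τ : Equiv.Perm (Fin n)) (i : Fin n) :
    insertTop c τ (c.succAbove i) = (τ i).castSucc := by
  simp [insertTop]

theorem exists_insertTop_eq {n : ℕ} (σ : Equiv.Perm (Fin (n + 1))) :
    ∃ τ, insertTop (σ.symm (Fin.last n)) τ = σ := by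
  set c := σ.symm (Fin.last n) with hc
  have hσc : σ c = Fin.last n := by simp [hc]
  let e : Option (Fin n) ≃ Option (Fin n) :=
    (finSuccEquiv' c).symm.trans (σ.trans (finSuccEquiv' (Fin.last n)))
  have he : e none = none := by simp [e, hσc]
  refine ⟨e.removeNone, ?_⟩
  have h : e.removeNone.optionCongr = e := by
    ext1 x
    cases x with
    | none => simp [he]
    | some x =>
      have hx : e (some x) ≠ none := fun h => by
        simpa using e.injective (h.trans he.symm)
      simp only [Equiv.optionCongr_apply, Option.map_some]
      exact Equiv.removeNone_some e (Option.ne_none_iff_exists'.1 hx)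
  rw [insertTop, h]
  ext1 x
  simp [e]

theorem insertTop_injective {n : ℕ} {c d : Fin (n + 1)} {τ υ : Equiv.Perm (Fin n)}
    (h : insertTop c τ = insertTop d υ) : c = d ∧ τ = υ := by
  have hcd : c = d := by
    apply (insertTop d υ).injective
    rw [insertTop_self, ← h, insertTop_self]
  subst hcd
  refine ⟨rfl, Equiv.ext fun i => ?_⟩
  simpa using congrArg (fun σ : Equiv.Perm (Fin (n + 1)) => σ (c.succAbove i)) h

theorem mem_shrink_iff {n : ℕ} (F : FerrersBoard (n + 1)) {c : Fin (n + 1)}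
    (hc : (c, Fin.last n) ∈ F.cells) (i j : Fin n) :
    (c.succAbove i, j.castSucc) ∈ F.cells ↔ (i, j) ∈ F.shrink.cells := by
  change _ ↔ (i.succ, j.castSucc) ∈ F.cells
  rcases lt_or_ge i.castSucc c with h | h
  · refine iff_of_true ?_ ?_ <;> refine F.downward_closed hc ?_ (Fin.le_last _)
    · rw [Fin.succAbove_of_castSucc_lt _ _ h]; exact h.le
    · exact Fin.castSucc_lt_iff_succ_le.1 h
  · rw [Fin.succAbove_of_le_castSucc _ _ h]

theorem isFilling_insertTop {n : ℕ} (F : FerrersBoard (n + 1)) (c : Fin (n + 1))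
    (τ : Equiv.Perm (Fin n)) :
    IsFilling F (insertTop c τ) ↔ (c, Fin.last n) ∈ F.cells ∧ IsFilling F.shrink τ := by
  constructor
  · intro h
    have hc : (c, Fin.last n) ∈ F.cells := by simpa using h c
    exact ⟨hc, fun i => (mem_shrink_iff F hc _ _).1 (by simpa using h (c.succAbove i))⟩
  · rintro ⟨hc, h⟩ i
    rcases Fin.eq_self_or_eq_succAbove c i with rfl | ⟨i, rfl⟩
    · simpa using hc
    · simpa using (mem_shrink_iff F hc _ _).2 (h i)

theorem hasTriple_insertTop (R : ℕ → ℕ → ℕ → Prop) {n : ℕ} (F : FerrersBoard (n + 1))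
    {c : Fin (n + 1)} (hc : (c, Fin.last n) ∈ F.cells) (τ : Equiv.Perm (Fin n)) :
    HasTriple R F (insertTop c τ) ↔ HasTriple R F.shrink τ ∨
      (∃ j k : Fin n, c.val ≤ j ∧ j < k ∧ (k.succ, Fin.last n) ∈ F.cells ∧ R n (τ j) (τ k)) ∨
      (∃ i k : Fin n, i.val < c ∧ c.val ≤ k ∧ (k.succ, Fin.last n) ∈ F.cells ∧
        R (τ i) n (τ k)) ∨
      (∃ i j : Fin n, i < j ∧ j.val < c ∧ R (τ i) (τ j) n) := by
  have hlt : ∀ i : Fin n, c.succAbove i < c ↔ i.val < c := fun i =>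
    Fin.succAbove_lt_iff_castSucc_lt c i
  have hgt : ∀ i : Fin n, c < c.succAbove i ↔ c.val ≤ i := fun i =>
    Fin.lt_succAbove_iff_le_castSucc c i
  have hs : ∀ i : Fin n, c.val ≤ i → c.succAbove i = i.succ := fun i h =>
    Fin.succAbove_of_le_castSucc c i h
  constructor
  · rintro ⟨i, j, k, hij, hjk, hR, h1, h2, h3⟩
    rcases Fin.eq_self_or_eq_succAbove c i with rfl | ⟨i, rfl⟩
    · rcases Fin.eq_self_or_eq_succAbove i j with rfl | ⟨j, rfl⟩
      · exact absurd hij (lt_irrefl _)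
      rcases Fin.eq_self_or_eq_succAbove i k with rfl | ⟨k, rfl⟩
      · exact absurd (hij.trans hjk) (lt_irrefl _)
      right; left
      have hk := (hgt k).1 (hij.trans hjk)
      refine ⟨j, k, (hgt j).1 hij, by simpa using hjk, ?_, by simpa using hR⟩
      rw [← hs k hk]; simpa using h1
    · rcases Fin.eq_self_or_eq_succAbove c j with rfl | ⟨j, rfl⟩
      · rcases Fin.eq_self_or_eq_succAbove j k with rfl | ⟨k, rfl⟩
        · exact absurd hjk (lt_irrefl _)
        right; right; left
        have hk := (hgt k).1 hjk
        refine ⟨i, k, (hlt i).1 hij, hk, ?_, by simpa using hR⟩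
        rw [← hs k hk]; simpa using h2
      · rcases Fin.eq_self_or_eq_succAbove c k with rfl | ⟨k, rfl⟩
        · right; right; right
          exact ⟨i, j, by simpa using hij, (hlt j).1 hjk, by simpa using hR⟩
        · left
          simp only [insertTop_succAbove, mem_shrink_iff F hc] at h1 h2 h3
          exact ⟨i, j, k, by simpa using hij, by simpa using hjk, by simpa using hR, h1, h2, h3⟩
  · rintro (⟨i, j, k, hij, hjk, hR, h1, h2, h3⟩ | ⟨j, k, hj, hjk, hk, hR⟩ |
      ⟨i, k, hi, hk, hF, hR⟩ | ⟨i, j, hij, hj, hR⟩)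
    · refine ⟨c.succAbove i, c.succAbove j, c.succAbove k, by simpa using hij, by simpa using hjk,
        by simpa using hR, ?_⟩
      simp only [insertTop_succAbove, mem_shrink_iff F hc]
      exact ⟨h1, h2, h3⟩
    · have hck : c.val ≤ k := hj.trans (le_of_lt hjk)
      rw [← hs k hck] at hk
      exact ⟨c, c.succAbove j, c.succAbove k, (hgt j).2 hj, by simpa using hjk, by simpa using hR,
        F.downward_closed hk le_rfl (Fin.le_last _), F.downward_closed hk le_rfl (Fin.le_last _),
        F.downward_closed hk le_rfl (Fin.le_last _)⟩
    · rw [← hs k hk] at hF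
      exact ⟨c.succAbove i, c, c.succAbove k, (hlt i).2 hi, (hgt k).2 hk, by simpa using hR,
        F.downward_closed hF le_rfl (Fin.le_last _), F.downward_closed hF le_rfl (Fin.le_last _),
        F.downward_closed hF le_rfl (Fin.le_last _)⟩
    · exact ⟨c.succAbove i, c.succAbove j, c, by simpa using hij, (hlt j).2 hj,
        by simpa using hR,
        F.downward_closed hc le_rfl (Fin.le_last _), F.downward_closed hc le_rfl (Fin.le_last _),
        F.downward_closed hc le_rfl (Fin.le_last _)⟩

/-- Every avoider of the shrunken board extends by a top rook in exactly two positions (just one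
if the top row has a single cell). -/
def TwoInsertions (R : ℕ → ℕ → ℕ → Prop) : Prop :=
  ∀ (n : ℕ) (F : FerrersBoard (n + 1)) (L : ℕ), 1 ≤ L → L ≤ n + 1 →
    (∀ c : Fin (n + 1), (c, Fin.last n) ∈ F.cells ↔ c.val < L) →
    ∀ τ : TripleAvoiders R F.shrink, ∃ a b : ℕ, a < L ∧ b < L ∧ (2 ≤ L → a ≠ b) ∧
      ∀ c : Fin (n + 1), c.val < L →
        (¬ HasTriple R F (insertTop c τ.1) ↔ c.val = a ∨ c.val = b)

theorem exists_topRow_length {n : ℕ} (F : FerrersBoard (n + 1)) :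
    ∃ L ≤ n + 1, ∀ c : Fin (n + 1), (c, Fin.last n) ∈ F.cells ↔ c.val < L := by
  by_cases h : ∃ L, ∃ hL : L < n + 1, ((⟨L, hL⟩ : Fin (n + 1)), Fin.last n) ∉ F.cells
  · classical
    obtain ⟨hlt, hL⟩ := Nat.find_spec h
    refine ⟨Nat.find h, hlt.le, fun c => ⟨fun hc => ?_, fun hc => ?_⟩⟩
    · by_contra hcon
      exact hL (F.downward_closed hc (Fin.le_def.2 (not_lt.1 hcon)) le_rfl)
    · by_contra hcon
      exact Nat.find_min h hc ⟨c.2, hcon⟩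
  · push Not at h
    exact ⟨n + 1, le_rfl, fun c => iff_of_true (h c c.2) c.2⟩

theorem exists_card_insertions {n : ℕ} (F : FerrersBoard (n + 1)) :
    ∃ m : ℕ, ∀ R, TwoInsertions R → ∀ τ : TripleAvoiders R F.shrink,
      Nat.card {c : Fin (n + 1) // (c, Fin.last n) ∈ F.cells ∧
        ¬ HasTriple R F (insertTop c τ.1)} = m := by
  obtain ⟨L, hLn, hL⟩ := exists_topRow_length F
  rcases Nat.eq_zero_or_pos L with rfl | hpos
  · refine ⟨0, fun R _ τ => ?_⟩
    have : IsEmpty {c : Fin (n + 1) // (c, Fin.last n) ∈ F.cells ∧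
        ¬ HasTriple R F (insertTop c τ.1)} := ⟨fun c => by simpa using (hL c.1).1 c.2.1⟩
    exact Nat.card_of_isEmpty
  · refine ⟨min 2 L, fun R hR τ => ?_⟩
    obtain ⟨a, b, ha, hb, hab, h⟩ := hR n F L hpos hLn hL τ
    have hset : {c : Fin (n + 1) | (c, Fin.last n) ∈ F.cells ∧
        ¬ HasTriple R F (insertTop c τ.1)} = {⟨a, by omega⟩, ⟨b, by omega⟩} := by
      ext c
      simp only [Set.mem_ofPred_eq, Set.mem_insert_iff, Set.mem_singleton_iff, Fin.ext_iff, hL]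
      constructor
      · rintro ⟨h1, h2⟩
        exact (h c h1).1 h2
      · intro h1
        have hc : c.val < L := by omega
        exact ⟨hc, (h c hc).2 h1⟩
    change Nat.card ↥({c : Fin (n + 1) | (c, Fin.last n) ∈ F.cells ∧
        ¬ HasTriple R F (insertTop c τ.1)}) = _
    rw [hset, Nat.card_coe_set_eq]
    by_cases h2 : 2 ≤ L
    · rw [Set.ncard_pair (by simpa using hab h2)]
      omega
    · obtain rfl : a = b := by omega
      simp
      omega

/-- An avoider is an avoider of the shrunken board together with an admissible position for the
top rook. -/
noncomputable def avoidersEquiv (R : ℕ → ℕ → ℕ → Prop) {n : ℕ} (F : FerrersBoard (n + 1)) :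
    (Σ τ : TripleAvoiders R F.shrink, {c : Fin (n + 1) // (c, Fin.last n) ∈ F.cells ∧
      ¬ HasTriple R F (insertTop c τ.1)}) ≃ TripleAvoiders R F :=
  Equiv.ofBijective
    (fun x => ⟨insertTop x.2.1 x.1.1,
      (isFilling_insertTop F _ _).2 ⟨x.2.2.1, x.1.2.1⟩, x.2.2.2⟩) <| by
    constructor
    · rintro ⟨⟨τ, hτ⟩, ⟨c, hc⟩⟩ ⟨⟨υ, hυ⟩, ⟨d, hd⟩⟩ h
      obtain ⟨rfl, rfl⟩ := insertTop_injective (Subtype.ext_iff.1 h)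
      rfl
    · rintro ⟨σ, hσ, hσR⟩
      obtain ⟨τ, hτ⟩ := exists_insertTop_eq σ
      rw [← hτ] at hσ hσR
      have hf := (isFilling_insertTop F _ _).1 hσ
      refine ⟨⟨⟨τ, hf.2, fun h => hσR ?_⟩, ⟨_, hf.1, hσR⟩⟩, Subtype.ext hτ⟩
      exact (hasTriple_insertTop R F hf.1 τ).2 (Or.inl h)

theorem card_avoiders_eq {R S : ℕ → ℕ → ℕ → Prop} (hR : TwoInsertions R) (hS : TwoInsertions S)
    {n : ℕ} (F : FerrersBoard n) :
    Nat.card (TripleAvoiders R F) = Nat.card (TripleAvoiders S F) := by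
  induction n with
  | zero =>
    have h : ∀ T, ∀ σ : Equiv.Perm (Fin 0), IsFilling F σ ∧ ¬ HasTriple T F σ := fun T σ =>
      ⟨fun i => i.elim0, fun ⟨i, _⟩ => i.elim0⟩
    exact Nat.card_congr (Equiv.subtypeEquivRight fun σ => iff_of_true (h R σ) (h S σ))
  | succ n ih =>
    obtain ⟨m, hm⟩ := exists_card_insertions F
    have key : ∀ T, TwoInsertions T →
        Nat.card (TripleAvoiders T F) = Nat.card (TripleAvoiders T F.shrink) * m := by
      intro T hT
      have := Fintype.ofFinite (TripleAvoiders T F.shrink)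
      rw [← Nat.card_congr (avoidersEquiv T F), Nat.card_sigma,
        Finset.sum_congr rfl fun τ _ => hm T hT τ, Finset.sum_const, Finset.card_univ,
        smul_eq_mul, Nat.card_eq_fintype_card]
    rw [key R hR, key S hS, ih]

theorem twoInsertions_maxFirst : TwoInsertions MaxFirst := by
  intro n F L hpos hLn hL τ
  refine ⟨L - 1, L - 2, by omega, by omega, by omega, fun c hc => ?_⟩
  rw [hasTriple_insertTop _ F ((hL c).2 hc)]
  simp only [τ.2.2, hL, MaxFirst, false_or, Fin.lt_def, Fin.val_succ]
  constructor
  · intro h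
    by_contra hcon
    exact h (Or.inl ⟨⟨c, by omega⟩, ⟨c + 1, by omega⟩, le_rfl, Nat.lt_succ_self _,
      by simp only; omega, Fin.is_lt _, Fin.is_lt _⟩)
  · rintro h (⟨j, k, h1⟩ | ⟨i, k, h1⟩ | ⟨i, j, h1⟩)
    · omega
    · omega
    · omega

theorem twoInsertions_maxMid : TwoInsertions MaxMid := by
  intro n F L hpos hLn hL τ
  refine ⟨0, L - 1, by omega, by omega, by omega, fun c hc => ?_⟩
  rw [hasTriple_insertTop _ F ((hL c).2 hc)]
  simp only [τ.2.2, hL, MaxMid, false_or, Fin.lt_def, Fin.val_succ]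
  constructor
  · intro h
    by_contra hcon
    exact h (Or.inr (Or.inl ⟨⟨0, by omega⟩, ⟨c, by omega⟩, by simp only; omega, le_rfl,
      by simp only; omega, Fin.is_lt _, Fin.is_lt _⟩))
  · rintro h (⟨j, k, h1⟩ | ⟨i, k, h1⟩ | ⟨i, j, h1⟩)
    · omega
    · omega
    · omega

theorem twoInsertions_maxLast : TwoInsertions MaxLast := by
  intro n F L hpos hLn hL τ
  refine ⟨0, min 1 (L - 1), by omega, by omega, by omega, fun c hc => ?_⟩
  rw [hasTriple_insertTop _ F ((hL c).2 hc)]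
  simp only [τ.2.2, hL, MaxLast, false_or, Fin.lt_def, Fin.val_succ]
  constructor
  · intro h
    by_contra hcon
    exact h (Or.inr (Or.inr ⟨⟨0, by omega⟩, ⟨1, by omega⟩, by simp, by simp only; omega,
      Fin.is_lt _, Fin.is_lt _⟩))
  · rintro h (⟨j, k, h1⟩ | ⟨i, k, h1⟩ | ⟨i, j, h1⟩)
    · omega
    · omega
    · omega

theorem twoInsertions_minMid : TwoInsertions MinMid := by
  intro n F L hpos hLn hL τ
  rcases Nat.lt_or_ge L 2 with h2 | h2
  · refine ⟨0, 0, by omega, by omega, by omega, fun c hc => ?_⟩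
    rw [hasTriple_insertTop _ F ((hL c).2 hc)]
    simp only [τ.2.2, hL, MinMid, false_or, Fin.lt_def, Fin.val_succ]
    refine iff_of_true ?_ (by omega)
    rintro (⟨j, k, h1⟩ | ⟨i, k, h1⟩ | ⟨i, j, h1⟩) <;> omega
  obtain ⟨m, hmL, hm⟩ : ∃ m : Fin n, m.val + 1 < L ∧
      ∀ i : Fin n, i.val + 1 < L → τ.1 i ≤ τ.1 m := by
    have hne : (Finset.univ.filter fun i : Fin n => i.val + 1 < L).Nonempty :=
      ⟨⟨0, by omega⟩, by simp; omega⟩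
    obtain ⟨m, hm, h⟩ := Finset.exists_max_image _ (fun i => τ.1 i) hne
    exact ⟨m, by simpa using hm, fun i hi => h i (by simpa using hi)⟩
  have hmlt : ∀ i : Fin n, i.val + 1 < L → i ≠ m → (τ.1 i).val < τ.1 m := fun i hi hne =>
    lt_of_le_of_ne (hm i hi) fun h => hne (τ.1.injective (Fin.ext h))
  have hcell : ∀ k j : Fin n, k.val + 1 < L → (k, j) ∈ F.shrink.cells := fun k j hk =>
    F.downward_closed ((hL k.succ).2 hk) le_rfl (Fin.le_last _)
  have hτ : ∀ i j k : Fin n, i.val < j → j.val < k → k.val + 1 < L →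
      (τ.1 j).val < τ.1 i → (τ.1 j).val < τ.1 k → False := fun i j k hij hjk hk h1 h3 =>
    τ.2.2 ⟨i, j, k, hij, hjk, ⟨h1, h3⟩, hcell _ _ hk, hcell _ _ hk, hcell _ _ hk⟩
  have hinj : ∀ i j : Fin n, i.val < j → (τ.1 i).val ≠ τ.1 j := fun i j hij h => by
    have := τ.1.injective (Fin.ext h)
    omega
  refine ⟨m, m + 1, by omega, by omega, by omega, fun c hc => ?_⟩
  rw [hasTriple_insertTop _ F ((hL c).2 hc)]
  simp only [τ.2.2, hL, MinMid, false_or, Fin.lt_def, Fin.val_succ]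
  constructor
  · intro h
    by_contra hcon
    rcases Nat.lt_or_ge c m with hcm | hcm
    · exact h (Or.inl ⟨⟨c, by omega⟩, m, le_rfl, hcm, hmL, Fin.is_lt _,
        hmlt _ (by simp only; omega) (by simp only [ne_eq, Fin.ext_iff]; omega)⟩)
    · exact h (Or.inr (Or.inr ⟨m, ⟨m + 1, by omega⟩, Nat.lt_succ_self _, by simp only; omega,
        hmlt _ (by simp only; omega) (by simp [Fin.ext_iff]), Fin.is_lt _⟩))
  · rintro h (⟨j, k, h1, h3, h4, h5, h6⟩ | ⟨i, k, h1, h3, h4, h5, h6⟩ | ⟨i, j, h1, h3, h4, h5⟩)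
    · have hjm : j ≠ m := by
        rintro rfl
        have := hm k h4
        rw [Fin.le_def] at this
        omega
      have hjm' : j.val ≠ m.val := fun h => hjm (Fin.ext h)
      exact hτ m j k (by omega) h3 h4 (hmlt j (by omega) hjm) h6
    · omega
    · have hjm : j ≠ m := by
        rintro rfl
        have := hm i (by omega)
        rw [Fin.le_def] at this
        omega
      have hjm' : j.val ≠ m.val := fun h => hjm (Fin.ext h)
      exact hτ i j m h1 (by omega) hmL h4 (hmlt j (by omega) hjm)

theorem card_avoiders_transpose {R S : ℕ → ℕ → ℕ → Prop}
    (hRS : ∀ {n : ℕ} (F : FerrersBoard n) (σ : Equiv.Perm (Fin n)),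
      HasTriple R F σ → HasTriple S F.transpose σ.symm)
    (hSR : ∀ {n : ℕ} (F : FerrersBoard n) (σ : Equiv.Perm (Fin n)),
      HasTriple S F σ → HasTriple R F.transpose σ.symm)
    {n : ℕ} (F : FerrersBoard n) :
    Nat.card (TripleAvoiders R F) = Nat.card (TripleAvoiders S F.transpose) := by
  refine Nat.card_congr (Equiv.subtypeEquiv ⟨Equiv.symm, Equiv.symm, fun _ => rfl, fun _ => rfl⟩
    fun σ => and_congr ?_ (not_congr ⟨hRS F σ, hSR F.transpose σ.symm⟩))
  constructor
  · intro h i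
    simpa [FerrersBoard.transpose] using h (σ.symm i)
  · intro h i
    simpa [FerrersBoard.transpose] using h (σ i)

theorem hasTriple_maxLast_transpose {n : ℕ} (F : FerrersBoard n) (σ : Equiv.Perm (Fin n))
    (h : HasTriple MaxLast F σ) : HasTriple MaxLast F.transpose σ.symm := by
  obtain ⟨i, j, k, hij, hjk, ⟨h1, h2⟩, c1, c2, c3⟩ := h
  have hik := hij.trans hjk
  rcases lt_trichotomy (σ i) (σ j) with h | h | h
  · refine ⟨σ i, σ j, σ k, h, h2, ?_, ?_⟩
    · simpa [MaxLast] using ⟨hik, hjk⟩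
    · simp only [FerrersBoard.transpose, Set.mem_ofPred_eq, Equiv.symm_apply_apply]
      exact ⟨F.downward_closed c3 hik.le le_rfl, F.downward_closed c3 hjk.le le_rfl, c3⟩
  · exact absurd (σ.injective h) hij.ne
  · refine ⟨σ j, σ i, σ k, h, h1, ?_, ?_⟩
    · simpa [MaxLast] using ⟨hjk, hik⟩
    · simp only [FerrersBoard.transpose, Set.mem_ofPred_eq, Equiv.symm_apply_apply]
      exact ⟨F.downward_closed c3 hjk.le le_rfl, F.downward_closed c3 hik.le le_rfl, c3⟩

theorem hasTriple_minLast_transpose {n : ℕ} (F : FerrersBoard n) (σ : Equiv.Perm (Fin n))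
    (h : HasTriple MinLast F σ) : HasTriple MaxFirst F.transpose σ.symm := by
  obtain ⟨i, j, k, hij, hjk, ⟨h1, h2⟩, c1, c2, c3⟩ := h
  have hik := hij.trans hjk
  rcases lt_trichotomy (σ i) (σ j) with h | h | h
  · refine ⟨σ k, σ i, σ j, h1, h, ?_, ?_⟩
    · simpa [MaxFirst] using ⟨hik, hjk⟩
    · simp only [FerrersBoard.transpose, Set.mem_ofPred_eq, Equiv.symm_apply_apply]
      exact ⟨c2, F.downward_closed c2 hik.le le_rfl, F.downward_closed c2 hjk.le le_rfl⟩
  · exact absurd (σ.injective h) hij.ne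
  · refine ⟨σ k, σ j, σ i, h2, h, ?_, ?_⟩
    · simpa [MaxFirst] using ⟨hjk, hik⟩
    · simp only [FerrersBoard.transpose, Set.mem_ofPred_eq, Equiv.symm_apply_apply]
      exact ⟨c1, F.downward_closed c1 hjk.le le_rfl, F.downward_closed c1 hik.le le_rfl⟩

theorem hasTriple_maxFirst_transpose {n : ℕ} (F : FerrersBoard n) (σ : Equiv.Perm (Fin n))
    (h : HasTriple MaxFirst F σ) : HasTriple MinLast F.transpose σ.symm := by
  obtain ⟨i, j, k, hij, hjk, ⟨h1, h2⟩, c1, c2, c3⟩ := h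
  have hik := hij.trans hjk
  have cj := F.downward_closed c1 hjk.le le_rfl
  have ci := F.downward_closed c1 hik.le le_rfl
  rcases lt_trichotomy (σ j) (σ k) with h | h | h
  · refine ⟨σ j, σ k, σ i, h, h2, ?_, ?_⟩
    · simpa [MinLast] using ⟨hij, hik⟩
    · simp only [FerrersBoard.transpose, Set.mem_ofPred_eq, Equiv.symm_apply_apply]
      exact ⟨cj, c1, ci⟩
  · exact absurd (σ.injective h) hjk.ne
  · refine ⟨σ k, σ j, σ i, h, h1, ?_, ?_⟩
    · simpa [MinLast] using ⟨hik, hij⟩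
    · simp only [FerrersBoard.transpose, Set.mem_ofPred_eq, Equiv.symm_apply_apply]
      exact ⟨c1, cj, ci⟩

theorem card_avoiders_minLast {n : ℕ} (F : FerrersBoard n) :
    Nat.card (TripleAvoiders MinLast F) = Nat.card (TripleAvoiders MaxLast F) :=
  calc Nat.card (TripleAvoiders MinLast F)
      = Nat.card (TripleAvoiders MaxFirst F.transpose) :=
        card_avoiders_transpose hasTriple_minLast_transpose hasTriple_maxFirst_transpose F
    _ = Nat.card (TripleAvoiders MaxLast F.transpose) :=
        card_avoiders_eq twoInsertions_maxFirst twoInsertions_maxLast _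
    _ = Nat.card (TripleAvoiders MaxLast F) :=
        (card_avoiders_transpose hasTriple_maxLast_transpose hasTriple_maxLast_transpose F).symm

theorem fillingContains_mkPattern_iff {n : ℕ} (F : FerrersBoard n) (σ : Equiv.Perm (Fin n))
    (v : Fin 3 → Fin 3) (hv : Function.Bijective v) :
    FillingContains F σ (mkPattern v hv) ↔ ∃ i j k : Fin n, i < j ∧ j < k ∧
      (∀ a b, σ (![i, j, k] a) < σ (![i, j, k] b) ↔ v a < v b) ∧
      (k, σ i) ∈ F.cells ∧ (k, σ j) ∈ F.cells ∧ (k, σ k) ∈ F.cells := by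
  constructor
  · rintro ⟨f, hf, hp, hc⟩
    change Fin 3 → Fin n at f
    have hf' : (![f 0, f 1, f 2] : Fin 3 → Fin n) = f := by
      ext a; fin_cases a <;> rfl
    refine ⟨f 0, f 1, f 2, hf (by decide : (0 : Fin 3) < 1), hf (by decide : (1 : Fin 3) < 2),
      fun a b => ?_, hc (2 : Fin 3) (0 : Fin 3), hc (2 : Fin 3) (1 : Fin 3),
      hc (2 : Fin 3) (2 : Fin 3)⟩
    rw [hf']
    exact hp a b
  · rintro ⟨i, j, k, hij, hjk, hp, c1, c2, c3⟩
    have hmono : StrictMono (![i, j, k] : Fin 3 → Fin n) := by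
      rw [Fin.strictMono_iff_lt_succ]
      intro a
      fin_cases a
      · exact hij
      · exact hjk
    refine ⟨![i, j, k], hmono, hp, fun a b => ?_⟩
    change Fin 3 at a b
    have hk : (k, σ ((![i, j, k] : Fin 3 → Fin n) b)) ∈ F.cells := by
      fin_cases b
      · exact c1
      · exact c2
      · exact c3
    exact F.downward_closed hk (hmono.monotone (Fin.le_last a)) le_rfl

/-- The pattern set `{v, w}` is described by the relation `R` on the values of three rooks. -/
theorem fillingAvoidsSet_pair_iff (R : ℕ → ℕ → ℕ → Prop) (v w : Fin 3 → Fin 3)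
    (hv : Function.Bijective v) (hw : Function.Bijective w)
    (hR : ∀ g : Fin 3 → ℕ, Function.Injective g → (R (g 0) (g 1) (g 2) ↔
      (∀ a b, g a < g b ↔ v a < v b) ∨ (∀ a b, g a < g b ↔ w a < w b)))
    {n : ℕ} (F : FerrersBoard n) (σ : Equiv.Perm (Fin n)) :
    FillingAvoidsSet F σ {mkPattern v hv, mkPattern w hw} ↔ ¬ HasTriple R F σ := by
  have key : ∀ i j k : Fin n, i < j → j < k → (R (σ i) (σ j) (σ k) ↔
      (∀ a b, σ (![i, j, k] a) < σ (![i, j, k] b) ↔ v a < v b) ∨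
      (∀ a b, σ (![i, j, k] a) < σ (![i, j, k] b) ↔ w a < w b)) := by
    intro i j k hij hjk
    refine hR (fun a => (σ (![i, j, k] a)).val)
      (Fin.val_injective.comp (σ.injective.comp (StrictMono.injective ?_)))
    rw [Fin.strictMono_iff_lt_succ]
    intro a
    fin_cases a
    · exact hij
    · exact hjk
  have h : FillingAvoidsSet F σ {mkPattern v hv, mkPattern w hw} ↔
      ¬ (FillingContains F σ (mkPattern v hv) ∨ FillingContains F σ (mkPattern w hw)) := by
    simp [FillingAvoidsSet]
  rw [h, fillingContains_mkPattern_iff, fillingContains_mkPattern_iff]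
  refine not_congr ⟨?_, ?_⟩
  · rintro (⟨i, j, k, hij, hjk, hp, hc⟩ | ⟨i, j, k, hij, hjk, hp, hc⟩)
    · exact ⟨i, j, k, hij, hjk, (key i j k hij hjk).2 (Or.inl hp), hc⟩
    · exact ⟨i, j, k, hij, hjk, (key i j k hij hjk).2 (Or.inr hp), hc⟩
  · rintro ⟨i, j, k, hij, hjk, hp, hc⟩
    rcases (key i j k hij hjk).1 hp with h | h
    · exact Or.inl ⟨i, j, k, hij, hjk, h, hc⟩
    · exact Or.inr ⟨i, j, k, hij, hjk, h, hc⟩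

/-- `S` is described by a relation whose avoiders are equinumerous with those of `MaxLast`. -/
def CountsAsMaxLast (S : Set Pattern) : Prop :=
  ∀ {n : ℕ} (F : FerrersBoard n),
    Nat.card {σ : Equiv.Perm (Fin n) // IsFilling F σ ∧ FillingAvoidsSet F σ S} =
      Nat.card (TripleAvoiders MaxLast F)

theorem countsAsMaxLast_pair (R : ℕ → ℕ → ℕ → Prop) (v w : Fin 3 → Fin 3)
    (hv : Function.Bijective v) (hw : Function.Bijective w)
    (hR : ∀ g : Fin 3 → ℕ, Function.Injective g → (R (g 0) (g 1) (g 2) ↔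
      (∀ a b, g a < g b ↔ v a < v b) ∨ (∀ a b, g a < g b ↔ w a < w b)))
    (hcard : ∀ {n : ℕ} (F : FerrersBoard n),
      Nat.card (TripleAvoiders R F) = Nat.card (TripleAvoiders MaxLast F)) :
    CountsAsMaxLast {mkPattern v hv, mkPattern w hw} := fun F =>
  (Nat.card_congr (Equiv.subtypeEquivRight fun σ =>
    and_congr_right fun _ => fillingAvoidsSet_pair_iff R v w hv hw hR F σ)).trans (hcard F)

theorem CountsAsMaxLast.shapeWilfEquiv {S T : Set Pattern} (hS : CountsAsMaxLast S)
    (hT : CountsAsMaxLast T) : ShapeWilfEquiv S T := fun _ _ F => (hS F).trans (hT F).symm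

/-- The pattern sets {312,321}, {132,231}, {123,213}, {231,321}, and {213,312}
are pairwise shape-Wilf-equivalent. -/
theorem stmt9 :
    List.Pairwise ShapeWilfEquiv
      [{mkPattern ![2,0,1], mkPattern ![2,1,0]},
       {mkPattern ![0,2,1], mkPattern ![1,2,0]},
       {mkPattern ![0,1,2], mkPattern ![1,0,2]},
       {mkPattern ![1,2,0], mkPattern ![2,1,0]},
       {mkPattern ![1,0,2], mkPattern ![2,0,1]}] := by
  have hne : ∀ g : Fin 3 → ℕ, Function.Injective g →
      g 0 ≠ g 1 ∧ g 0 ≠ g 2 ∧ g 1 ≠ g 2 := fun g hg =>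
    ⟨hg.ne (by decide), hg.ne (by decide), hg.ne (by decide)⟩
  have hA : CountsAsMaxLast {mkPattern ![2,0,1], mkPattern ![2,1,0]} := by
    refine countsAsMaxLast_pair MaxFirst _ _ _ _ (fun g hg => ?_)
      (card_avoiders_eq twoInsertions_maxFirst twoInsertions_maxLast)
    have := hne g hg
    simp [Fin.forall_fin_succ, MaxFirst]
    omega
  have hB : CountsAsMaxLast {mkPattern ![0,2,1], mkPattern ![1,2,0]} := by
    refine countsAsMaxLast_pair MaxMid _ _ _ _ (fun g hg => ?_)
      (card_avoiders_eq twoInsertions_maxMid twoInsertions_maxLast)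
    have := hne g hg
    simp [Fin.forall_fin_succ, MaxMid]
    omega
  have hC : CountsAsMaxLast {mkPattern ![0,1,2], mkPattern ![1,0,2]} := by
    refine countsAsMaxLast_pair MaxLast _ _ _ _ (fun g hg => ?_) (fun _ => rfl)
    have := hne g hg
    simp [Fin.forall_fin_succ, MaxLast]
    omega
  have hD : CountsAsMaxLast {mkPattern ![1,2,0], mkPattern ![2,1,0]} := by
    refine countsAsMaxLast_pair MinLast _ _ _ _ (fun g hg => ?_) card_avoiders_minLast
    have := hne g hg
    simp [Fin.forall_fin_succ, MinLast]
    omega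
  have hE : CountsAsMaxLast {mkPattern ![1,0,2], mkPattern ![2,0,1]} := by
    refine countsAsMaxLast_pair MinMid _ _ _ _ (fun g hg => ?_)
      (card_avoiders_eq twoInsertions_minMid twoInsertions_maxLast)
    have := hne g hg
    simp [Fin.forall_fin_succ, MinMid]
    omega
  simp only [List.pairwise_cons, List.mem_cons, List.not_mem_nil, or_false, forall_eq_or_imp,
    forall_eq, List.Pairwise.nil, and_true, false_imp_iff, implies_true]
  exact ⟨⟨hA.shapeWilfEquiv hB, hA.shapeWilfEquiv hC, hA.shapeWilfEquiv hD,
      hA.shapeWilfEquiv hE⟩,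
    ⟨hB.shapeWilfEquiv hC, hB.shapeWilfEquiv hD, hB.shapeWilfEquiv hE⟩,
    ⟨hC.shapeWilfEquiv hD, hC.shapeWilfEquiv hE⟩, hD.shapeWilfEquiv hE⟩
end

section
/- The pattern sets {31245, 32145} and {31254, 32154} are Wilf-equivalent. -/
open Equiv

/-- The cell `(i, j)` is shaded by `π` if an occurrence of `312` or `321` in `π` lies strictly to
the left of column `i` and strictly below row `j`. -/
def Shaded {n : ℕ} (π : Perm (Fin n)) (i j : Fin n) : Prop :=
  ∃ a b c : Fin n, a < b ∧ b < c ∧ c < i ∧ π b < π a ∧ π c < π a ∧ π a < j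

theorem Shaded.mono {n : ℕ} {π : Perm (Fin n)} {i i' j j' : Fin n} (h : Shaded π i j)
    (hi : i ≤ i') (hj : j ≤ j') : Shaded π i' j' := by
  obtain ⟨a, b, c, hab, hbc, hc, hb, hca, ha⟩ := h
  exact ⟨a, b, c, hab, hbc, hc.trans_le hi, hb, hca, ha.trans_le hj⟩

/-- A shaded cell is witnessed by an occurrence none of whose points is shaded. -/
theorem Shaded.exists_not_shaded {n : ℕ} {π : Perm (Fin n)} {i j : Fin n} (h : Shaded π i j) :
    ∃ a b c : Fin n, (a < b ∧ b < c ∧ c < i ∧ π b < π a ∧ π c < π a ∧ π a < j) ∧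
      ¬ Shaded π a (π a) ∧ ¬ Shaded π b (π b) ∧ ¬ Shaded π c (π c) := by
  induction i using WellFoundedLT.induction with
  | ind i ih =>
    have descend : ∀ d, d < i → π d < j → Shaded π d (π d) →
        ∃ a b c : Fin n, (a < b ∧ b < c ∧ c < i ∧ π b < π a ∧ π c < π a ∧ π a < j) ∧
          ¬ Shaded π a (π a) ∧ ¬ Shaded π b (π b) ∧ ¬ Shaded π c (π c) := by
      intro d hd hdj hs
      obtain ⟨a, b, c, ⟨h1, h2, h3, h4⟩, h5⟩ := ih d hd (hs.mono le_rfl hdj.le)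
      exact ⟨a, b, c, ⟨h1, h2, h3.trans hd, h4⟩, h5⟩
    obtain ⟨a, b, c, hab, hbc, hc, hb, hca, ha⟩ := h
    by_cases sa : Shaded π a (π a)
    · exact descend a (hab.trans (hbc.trans hc)) ha sa
    by_cases sb : Shaded π b (π b)
    · exact descend b (hbc.trans hc) (hb.trans ha) sb
    by_cases sc : Shaded π c (π c)
    · exact descend c hc (hca.trans ha) sc
    exact ⟨a, b, c, ⟨hab, hbc, hc, hb, hca, ha⟩, sa, sb, sc⟩

/-- Moving shaded points to shaded cells does not change the shading. -/
theorem shaded_eq_of_forall {n : ℕ} {π σ : Perm (Fin n)}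
    (h : ∀ i, π i = σ i ∨ (Shaded π i (π i) ∧ Shaded π i (σ i))) : Shaded π = Shaded σ := by
  ext i j
  constructor
  · intro hs
    obtain ⟨a, b, c, ⟨h1, h2, h3, h4, h5, h6⟩, ha, hb, hc⟩ := hs.exists_not_shaded
    have ea := (h a).resolve_right fun h' => ha h'.1
    have eb := (h b).resolve_right fun h' => hb h'.1
    have ec := (h c).resolve_right fun h' => hc h'.1
    rw [ea] at h4 h5 h6
    exact ⟨a, b, c, h1, h2, h3, eb ▸ h4, ec ▸ h5, h6⟩
  · rintro ⟨a, b, c, h1, h2, h3, h4, h5, h6⟩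
    rcases h a with ea | ⟨-, sa⟩
    · rcases h b with eb | ⟨-, sb⟩
      · rcases h c with ec | ⟨-, sc⟩
        · rw [← ea] at h4 h5 h6
          exact ⟨a, b, c, h1, h2, h3, eb ▸ h4, ec ▸ h5, h6⟩
        · exact sc.mono h3.le (h5.trans h6).le
      · exact sb.mono (h2.trans h3).le (h4.trans h6).le
    · exact sa.mono (h1.trans (h2.trans h3)).le h6.le

/-- Two permutations are identified when they have the same shading and the same unshaded
points. -/
def shadingSetoid (n : ℕ) : Setoid (Perm (Fin n)) where
  r π σ := Shaded π = Shaded σ ∧ ∀ i, π i = σ i ∨ (Shaded π i (π i) ∧ Shaded π i (σ i))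
  iseqv := by
    refine ⟨fun π => ⟨rfl, fun i => .inl rfl⟩, ?_, ?_⟩
    · rintro π σ ⟨h, h'⟩
      refine ⟨h.symm, fun i => ?_⟩
      rw [← h]
      exact (h' i).imp Eq.symm And.symm
    · rintro π σ ρ ⟨h₁, h₁'⟩ ⟨h₂, h₂'⟩
      refine ⟨h₁.trans h₂, fun i => ?_⟩
      rw [← h₁] at h₂'
      rcases h₁' i with e | ⟨s, s'⟩
      · rw [e]
        exact h₂' i
      · rcases h₂' i with e' | ⟨-, t⟩
        · exact .inr ⟨s, e' ▸ s'⟩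
        · exact .inr ⟨s, t⟩

theorem shadingSetoid_mul_swap {n : ℕ} {π : Perm (Fin n)} {i k : Fin n}
    (h₁ : Shaded π i (π i)) (h₂ : Shaded π i (π k)) (h₃ : Shaded π k (π i))
    (h₄ : Shaded π k (π k)) : shadingSetoid n (π * swap i k) π := by
  have h : ∀ l, π l = (π * swap i k) l ∨
      (Shaded π l (π l) ∧ Shaded π l ((π * swap i k) l)) := by
    intro l
    rcases eq_or_ne l i with rfl | hi
    · exact .inr ⟨h₁, by simpa using h₂⟩
    rcases eq_or_ne l k with rfl | hk
    · exact .inr ⟨h₄, by simpa using h₃⟩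
    · exact .inl (by simp [swap_apply_of_ne_of_ne hi hk])
  exact (shadingSetoid n).symm ⟨shaded_eq_of_forall h, h⟩

/-- Two distinct equivalent permutations first differ at a position where both are shaded, and the
value taken by either one there is taken later by the other. -/
theorem exists_first_difference {n : ℕ} {π σ : Perm (Fin n)} (h : shadingSetoid n π σ)
    (hne : π ≠ σ) : ∃ i, π i ≠ σ i ∧ Shaded π i (π i) ∧ Shaded π i (σ i) ∧
      (∃ k, i < k ∧ π k = σ i) ∧ ∃ k, i < k ∧ σ k = π i := by
  have hex : ∃ i, π i ≠ σ i := by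
    by_contra! h'
    exact hne (Equiv.ext h')
  obtain ⟨i, hi, hmin⟩ := WellFounded.has_min (wellFounded_lt (α := Fin n)) {i | π i ≠ σ i} hex
  have hlt : ∀ k, k < i → π k = σ k := fun k hk => by
    by_contra h'
    exact hmin k h' hk
  obtain ⟨s, s'⟩ := (h.2 i).resolve_left hi
  refine ⟨i, hi, s, s', ⟨π.symm (σ i), ?_, by simp⟩, ⟨σ.symm (π i), ?_, by simp⟩⟩
  · rcases lt_trichotomy (π.symm (σ i)) i with hk | hk | hk
    · have := hlt _ hk
      rw [apply_symm_apply] at this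
      exact absurd (σ.injective this) hk.ne'
    · exact absurd ((symm_apply_eq π).1 hk).symm hi
    · exact hk
  · rcases lt_trichotomy (σ.symm (π i)) i with hk | hk | hk
    · have := hlt _ hk
      rw [apply_symm_apply] at this
      exact absurd (π.injective this) hk.ne
    · exact absurd ((symm_apply_eq σ).1 hk) hi
    · exact hk

/-- `π` has two increasing points spanning shaded cells. -/
def HasShadedAscent {n : ℕ} (π : Perm (Fin n)) : Prop :=
  ∃ i k, i < k ∧ π i < π k ∧ Shaded π i (π i)

/-- `π` has two decreasing points spanning shaded cells. -/
def HasShadedDescent {n : ℕ} (π : Perm (Fin n)) : Prop :=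
  ∃ i k, i < k ∧ π k < π i ∧ Shaded π i (π k)

theorem eq_of_not_hasShadedAscent {n : ℕ} {π σ : Perm (Fin n)} (h : shadingSetoid n π σ)
    (hπ : ¬ HasShadedAscent π) (hσ : ¬ HasShadedAscent σ) : π = σ := by
  by_contra hne
  obtain ⟨i, hi, s, s', ⟨k, hk, ek⟩, l, hl, el⟩ := exists_first_difference h hne
  rcases hi.lt_or_gt with hlt | hlt
  · exact hπ ⟨i, k, hk, ek ▸ hlt, s⟩
  · exact hσ ⟨i, l, hl, el ▸ hlt, h.1 ▸ s'⟩

theorem eq_of_not_hasShadedDescent {n : ℕ} {π σ : Perm (Fin n)} (h : shadingSetoid n π σ)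
    (hπ : ¬ HasShadedDescent π) (hσ : ¬ HasShadedDescent σ) : π = σ := by
  by_contra hne
  obtain ⟨i, hi, s, s', ⟨k, hk, ek⟩, l, hl, el⟩ := exists_first_difference h hne
  rcases hi.lt_or_gt with hlt | hlt
  · exact hσ ⟨i, l, hl, el ▸ hlt, by rw [el, ← h.1]; exact s⟩
  · exact hπ ⟨i, k, hk, ek ▸ hlt, ek ▸ s'⟩

theorem toLex_lt_mul_swap {n : ℕ} {π : Perm (Fin n)} {i k : Fin n} (hik : i < k)
    (h : π i < π k) : toLex ⇑π < toLex ⇑(π * swap i k) := by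
  refine ⟨i, fun j hj => ?_, ?_⟩
  · simp [swap_apply_of_ne_of_ne hj.ne (hj.trans hik).ne]
  · simpa using h

theorem toLex_mul_swap_lt {n : ℕ} {π : Perm (Fin n)} {i k : Fin n} (hik : i < k)
    (h : π k < π i) : toLex ⇑(π * swap i k) < toLex ⇑π := by
  refine ⟨i, fun j hj => ?_, ?_⟩
  · simp [swap_apply_of_ne_of_ne hj.ne (hj.trans hik).ne]
  · simpa using h

theorem exists_not_hasShadedAscent {n : ℕ} (π : Perm (Fin n)) :
    ∃ σ, shadingSetoid n σ π ∧ ¬ HasShadedAscent σ := by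
  obtain ⟨σ, hσ, hmax⟩ := Set.exists_max_image {σ | shadingSetoid n σ π}
    (fun σ => toLex ⇑σ) (Set.toFinite _) ⟨π, (shadingSetoid n).refl π⟩
  refine ⟨σ, hσ, ?_⟩
  rintro ⟨i, k, hik, hlt, s⟩
  have hrel := shadingSetoid_mul_swap s (s.mono le_rfl hlt.le) (s.mono hik.le le_rfl)
    (s.mono hik.le hlt.le)
  exact (hmax _ ((shadingSetoid n).trans hrel hσ)).not_gt (toLex_lt_mul_swap hik hlt)

theorem exists_not_hasShadedDescent {n : ℕ} (π : Perm (Fin n)) :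
    ∃ σ, shadingSetoid n σ π ∧ ¬ HasShadedDescent σ := by
  obtain ⟨σ, hσ, hmin⟩ := Set.exists_min_image {σ | shadingSetoid n σ π}
    (fun σ => toLex ⇑σ) (Set.toFinite _) ⟨π, (shadingSetoid n).refl π⟩
  refine ⟨σ, hσ, ?_⟩
  rintro ⟨i, k, hik, hlt, s⟩
  have hrel := shadingSetoid_mul_swap (s.mono le_rfl hlt.le) s (s.mono hik.le hlt.le)
    (s.mono hik.le le_rfl)
  exact (hmin _ ((shadingSetoid n).trans hrel hσ)).not_gt (toLex_mul_swap_lt hik hlt)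

/-- A predicate selecting exactly one element of each equivalence class is counted by the
quotient. -/
theorem Setoid.card_subtype_eq_card_quotient {α : Type*} (s : Setoid α) {p : α → Prop}
    (hinj : ∀ a b, s a b → p a → p b → a = b) (hsurj : ∀ a, ∃ b, s b a ∧ p b) :
    Nat.card {a // p a} = Nat.card (Quotient s) := by
  refine Nat.card_eq_of_bijective (fun a : {a // p a} => (Quotient.mk s a.1)) ⟨?_, ?_⟩
  · rintro ⟨a, ha⟩ ⟨b, hb⟩ h
    exact Subtype.ext (hinj a b (Quotient.exact h) ha hb)
  · intro q
    induction q using Quotient.inductionOn with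
    | h a =>
      obtain ⟨b, hb, hp⟩ := hsurj a
      exact ⟨⟨b, hp⟩, Quotient.sound hb⟩

/-- A pattern of length five occurs if and only if five points are in the prescribed relative
order. -/
theorem permContains_mkPattern_five {n : ℕ} (π : Perm (Fin n)) (v : Fin 5 → Fin 5)
    (hv : Function.Bijective v) :
    PermContains π (mkPattern v hv) ↔ ∃ a b c i k : Fin n, a < b ∧ b < c ∧ c < i ∧ i < k ∧
      ∀ x y : Fin 5, π (![a, b, c, i, k] x) < π (![a, b, c, i, k] y) ↔ v x < v y := by
  constructor
  · rintro ⟨f, hf, h⟩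
    change Fin 5 → Fin n at f
    change ∀ x y : Fin 5, π (f x) < π (f y) ↔ v x < v y at h
    refine ⟨f 0, f 1, f 2, f 3, f 4, hf (by decide : (0 : Fin 5) < 1),
      hf (by decide : (1 : Fin 5) < 2), hf (by decide : (2 : Fin 5) < 3),
      hf (by decide : (3 : Fin 5) < 4), ?_⟩
    have hfe : ![f 0, f 1, f 2, f 3, f 4] = f := by
      ext x
      fin_cases x <;> rfl
    rwa [hfe]
  · rintro ⟨a, b, c, i, k, hab, hbc, hci, hik, h⟩
    refine ⟨![a, b, c, i, k], ?_, h⟩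
    refine Fin.strictMono_iff_lt_succ.2 fun x => ?_
    change Fin 4 at x
    fin_cases x
    exacts [hab, hbc, hci, hik]

theorem avoidsSet_ascent_iff {n : ℕ} (π : Perm (Fin n)) :
    AvoidsSet π {mkPattern ![2,0,1,3,4], mkPattern ![2,1,0,3,4]} ↔ ¬ HasShadedAscent π := by
  simp only [AvoidsSet, Set.mem_insert_iff, Set.mem_singleton_iff, forall_eq_or_imp, forall_eq,
    permContains_mkPattern_five, ← not_or]
  refine not_congr ⟨?_, ?_⟩
  · rintro (⟨a, b, c, i, k, hab, hbc, hci, hik, h⟩ | ⟨a, b, c, i, k, hab, hbc, hci, hik, h⟩) <;>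
      exact ⟨i, k, hik, (h 3 4).2 (by decide), a, b, c, hab, hbc, hci, (h 1 0).2 (by decide),
        (h 2 0).2 (by decide), (h 0 3).2 (by decide)⟩
  · rintro ⟨i, k, hik, hlt, a, b, c, hab, hbc, hci, hba, hca, hai⟩
    rcases lt_or_gt_of_ne (π.injective.ne hbc.ne) with hc | hc
    · refine .inl ⟨a, b, c, i, k, hab, hbc, hci, hik, fun x y => ?_⟩
      fin_cases x <;> fin_cases y <;> simp <;> order
    · refine .inr ⟨a, b, c, i, k, hab, hbc, hci, hik, fun x y => ?_⟩
      fin_cases x <;> fin_cases y <;> simp <;> order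

theorem avoidsSet_descent_iff {n : ℕ} (π : Perm (Fin n)) :
    AvoidsSet π {mkPattern ![2,0,1,4,3], mkPattern ![2,1,0,4,3]} ↔ ¬ HasShadedDescent π := by
  simp only [AvoidsSet, Set.mem_insert_iff, Set.mem_singleton_iff, forall_eq_or_imp, forall_eq,
    permContains_mkPattern_five, ← not_or]
  refine not_congr ⟨?_, ?_⟩
  · rintro (⟨a, b, c, i, k, hab, hbc, hci, hik, h⟩ | ⟨a, b, c, i, k, hab, hbc, hci, hik, h⟩) <;>
      exact ⟨i, k, hik, (h 4 3).2 (by decide), a, b, c, hab, hbc, hci, (h 1 0).2 (by decide),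
        (h 2 0).2 (by decide), (h 0 4).2 (by decide)⟩
  · rintro ⟨i, k, hik, hlt, a, b, c, hab, hbc, hci, hba, hca, hai⟩
    rcases lt_or_gt_of_ne (π.injective.ne hbc.ne) with hc | hc
    · refine .inl ⟨a, b, c, i, k, hab, hbc, hci, hik, fun x y => ?_⟩
      fin_cases x <;> fin_cases y <;> simp <;> order
    · refine .inr ⟨a, b, c, i, k, hab, hbc, hci, hik, fun x y => ?_⟩
      fin_cases x <;> fin_cases y <;> simp <;> order

/-- The pattern sets {31245, 32145} and {31254, 32154} are Wilf-equivalent. -/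
theorem stmt12 : WilfEquiv {mkPattern ![2,0,1,3,4], mkPattern ![2,1,0,3,4]} {mkPattern ![2,0,1,4,3], mkPattern ![2,1,0,4,3]} := by
  intro n _
  simp only [avoidsSet_ascent_iff, avoidsSet_descent_iff]
  exact ((shadingSetoid n).card_subtype_eq_card_quotient
    (fun _ _ => eq_of_not_hasShadedAscent) exists_not_hasShadedAscent).trans
    ((shadingSetoid n).card_subtype_eq_card_quotient
      (fun _ _ => eq_of_not_hasShadedDescent) exists_not_hasShadedDescent).symm
end
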